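/- (Level-α test from McDiarmid, null hypothesis) Under p = q, m = n, kernel bounds 0 ≤ k ≤ K, and F the unit ball of the RKHS, Pr{ MMD_b[F,X,X'] > (2K/m)^{1/2} + ε } ≤ exp(−ε² m / (4K)). Consequently the acceptance region MMD_b < √(2K/m)(1 + √(2 log(1/α))) gives a test of level α. -/

import Mathlib

open MeasureTheory
open scoped RealInnerProductSpace BigOperators

section MMDHelpers

set_option linter.unusedSectionVars false

variable {Z : Type*} [MeasurableSpace Z] {H : Type*} [NormedAddCommGroup H]
    [InnerProductSpace ℝ H]

/-- Boundedness on balls. -/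
def LocBdd (g : H → ℝ) : Prop := ∀ R : ℝ, ∃ C : ℝ, ∀ w, ‖w‖ ≤ R → |g w| ≤ C

lemma integrable_comp_of_locBdd {g : H → ℝ} (hg : Continuous g) (hb : LocBdd g)
    (μ : Measure Z) [IsProbabilityMeasure μ] {d : Z → H} (hd : AEStronglyMeasurable d μ)
    {R : ℝ} (hR : ∀ z, ‖d z‖ ≤ R) : Integrable (fun z => g (d z)) μ := by
  obtain ⟨C, hC⟩ := hb R
  exact Integrable.of_bound (hg.comp_aestronglyMeasurable hd) C
    (Filter.Eventually.of_forall fun z => hC _ (hR z))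

lemma norm_sum_le_aux {d : Z → H} {B : ℝ} (hB : ∀ z, ‖d z‖ ≤ B) (v : H) (n : ℕ)
    (ω : Fin n → Z) : ‖v + ∑ i, d (ω i)‖ ≤ ‖v‖ + n * B := by
  refine (norm_add_le _ _).trans (add_le_add le_rfl ?_)
  refine (norm_sum_le _ _).trans ((Finset.sum_le_sum fun i _ => hB (ω i)).trans ?_)
  simp

lemma aesm_sum (μ : Measure Z) [IsProbabilityMeasure μ] {d : Z → H}
    (hd : AEStronglyMeasurable d μ) (v : H) (n : ℕ) :
    AEStronglyMeasurable (fun ω : Fin n → Z => v + ∑ i, d (ω i))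
      (Measure.pi fun _ : Fin n => μ) := by
  refine aestronglyMeasurable_const.add ?_
  refine Finset.aestronglyMeasurable_fun_sum _ fun i _ => ?_
  exact hd.comp_quasiMeasurePreserving (Measure.quasiMeasurePreserving_eval _ i)

lemma integrable_sum {g : H → ℝ} (hg : Continuous g) (hb : LocBdd g)
    (μ : Measure Z) [IsProbabilityMeasure μ] {d : Z → H}
    (hd : AEStronglyMeasurable d μ) {B : ℝ} (hB : ∀ z, ‖d z‖ ≤ B) (v : H) (n : ℕ) :
    Integrable (fun ω : Fin n → Z => g (v + ∑ i, d (ω i))) (Measure.pi fun _ : Fin n => μ) :=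
  integrable_comp_of_locBdd hg hb _ (aesm_sum μ hd v n) (norm_sum_le_aux hB v n)

lemma integral_succ {g : H → ℝ} (hg : Continuous g) (hb : LocBdd g)
    (μ : Measure Z) [IsProbabilityMeasure μ] {d : Z → H}
    (hd : AEStronglyMeasurable d μ) {B : ℝ} (hB : ∀ z, ‖d z‖ ≤ B) (v : H) (n : ℕ) :
    ∫ ω : Fin (n + 1) → Z, g (v + ∑ i, d (ω i)) ∂(Measure.pi fun _ : Fin (n + 1) => μ)
      = ∫ z, ∫ ω : Fin n → Z, g ((v + d z) + ∑ i, d (ω i)) ∂(Measure.pi fun _ : Fin n => μ) ∂μ := by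
  have hmp := measurePreserving_piFinSuccAbove (fun _ : Fin (n + 1) => μ) 0
  have hmp' := hmp.symm
  have hint := integrable_sum hg hb μ hd hB v (n + 1)
  rw [← hmp'.integral_comp']
  have hint' := (hmp'.integrable_comp_emb (MeasurableEquiv.measurableEmbedding _)).2 hint
  rw [integral_prod]
  · refine integral_congr_ae (Filter.Eventually.of_forall fun z => ?_)
    refine integral_congr_ae (Filter.Eventually.of_forall fun ω => ?_)
    simp [Fin.sum_univ_succ, MeasurableEquiv.piFinSuccAbove, Fin.insertNthEquiv, add_assoc]
  · exact hint'

lemma lip_cont {g : H → ℝ} (hg : ∀ a b, |g a - g b| ≤ ‖a - b‖) : Continuous g := by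
  have : LipschitzWith 1 g := LipschitzWith.of_dist_le_mul fun a b => by
    simpa [Real.dist_eq, dist_eq_norm] using hg a b
  exact this.continuous

lemma lip_locBdd {g : H → ℝ} (hg : ∀ a b, |g a - g b| ≤ ‖a - b‖) : LocBdd g := by
  intro R
  refine ⟨|g 0| + R, fun w hw => ?_⟩
  have h1 := hg w 0
  have h2 : |g w| ≤ |g w - g 0| + |g 0| := by
    simpa using abs_add_le (g w - g 0) (g 0)
  rw [sub_zero] at h1
  linarith

lemma exp_lip {g : H → ℝ} (hg : ∀ a b, |g a - g b| ≤ ‖a - b‖) (t c : ℝ) :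
    Continuous (fun w => Real.exp (t * g w + c)) ∧ LocBdd (fun w => Real.exp (t * g w + c)) := by
  have hc := lip_cont hg
  refine ⟨by fun_prop, fun R => ?_⟩
  obtain ⟨C, hC⟩ := lip_locBdd hg R
  refine ⟨Real.exp (|t| * C + c), fun w hw => ?_⟩
  rw [abs_of_pos (Real.exp_pos _)]
  refine Real.exp_le_exp.2 (add_le_add ?_ le_rfl)
  calc t * g w ≤ |t * g w| := le_abs_self _
    _ = |t| * |g w| := abs_mul _ _
    _ ≤ |t| * C := mul_le_mul_of_nonneg_left (hC w hw) (abs_nonneg t)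

lemma hoeffding_step {g : H → ℝ} (hg : ∀ a b, |g a - g b| ≤ ‖a - b‖)
    (μ : Measure Z) [IsProbabilityMeasure μ] {d : Z → H}
    (hd : AEStronglyMeasurable d μ) {B : ℝ} (hB0 : 0 ≤ B) (hB : ∀ z, ‖d z‖ ≤ B) (v : H) (t : ℝ) :
    ∫ z, Real.exp (t * g (v + d z)) ∂μ
      ≤ Real.exp (t * (∫ z, g (v + d z) ∂μ) + B ^ 2 * t ^ 2 / 2) := by
  have hm : AEMeasurable (fun z => g (v + d z)) μ :=
    ((lip_cont hg).comp_aestronglyMeasurable (aestronglyMeasurable_const.add hd)).aemeasurable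
  have hI : ∀ᵐ z ∂μ, g (v + d z) ∈ Set.Icc (g v - B) (g v + B) := by
    refine Filter.Eventually.of_forall fun z => ?_
    have h := hg (v + d z) v
    rw [add_sub_cancel_left] at h
    have h' := abs_le.1 (h.trans (hB z))
    constructor <;> linarith
  have h := (ProbabilityTheory.hasSubgaussianMGF_of_mem_Icc hm hI).mgf_le t
  have hcst : (((‖(g v + B) - (g v - B)‖₊ / 2) ^ 2 : NNReal) : ℝ) = B ^ 2 := by
    have : (g v + B) - (g v - B) = 2 * B := by ring
    push_cast
    rw [this, Real.norm_of_nonneg (by positivity)]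
    ring
  rw [hcst, ProbabilityTheory.mgf] at h
  have he : ∀ z, Real.exp (t * (g (v + d z) - ∫ z, g (v + d z) ∂μ))
      = Real.exp (t * g (v + d z)) * Real.exp (-(t * ∫ z, g (v + d z) ∂μ)) := fun z => by
    rw [← Real.exp_add]; congr 1; ring
  simp_rw [he] at h
  rw [integral_mul_const, Real.exp_neg, ← div_eq_mul_inv, div_le_iff₀ (Real.exp_pos _),
    ← Real.exp_add] at h
  rwa [add_comm] at h

lemma mean_lip {g : H → ℝ} (hg : ∀ a b, |g a - g b| ≤ ‖a - b‖)
    (μ : Measure Z) [IsProbabilityMeasure μ] {d : Z → H}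
    (hd : AEStronglyMeasurable d μ) {B : ℝ} (hB : ∀ z, ‖d z‖ ≤ B) (n : ℕ) (a b : H) :
    |(∫ ω : Fin n → Z, g (a + ∑ i, d (ω i)) ∂(Measure.pi fun _ : Fin n => μ))
      - ∫ ω : Fin n → Z, g (b + ∑ i, d (ω i)) ∂(Measure.pi fun _ : Fin n => μ)| ≤ ‖a - b‖ := by
  have hi := integrable_sum (lip_cont hg) (lip_locBdd hg) μ hd hB
  rw [← integral_sub (hi a n) (hi b n)]
  have := norm_integral_le_of_norm_le_const (μ := Measure.pi fun _ : Fin n => μ)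
    (f := fun ω : Fin n → Z => g (a + ∑ i, d (ω i)) - g (b + ∑ i, d (ω i))) (C := ‖a - b‖)
    (Filter.Eventually.of_forall fun ω => by
      have := hg (a + ∑ i, d (ω i)) (b + ∑ i, d (ω i))
      rwa [add_sub_add_right_eq_sub] at this)
  simpa using this

lemma mgf_sum {g : H → ℝ} (hg : ∀ a b, |g a - g b| ≤ ‖a - b‖)
    (μ : Measure Z) [IsProbabilityMeasure μ] {d : Z → H}
    (hd : AEStronglyMeasurable d μ) {B : ℝ} (hB0 : 0 ≤ B) (hB : ∀ z, ‖d z‖ ≤ B) (t : ℝ) (n : ℕ) :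
    ∀ v : H, ∫ ω : Fin n → Z, Real.exp (t * g (v + ∑ i, d (ω i))) ∂(Measure.pi fun _ : Fin n => μ)
      ≤ Real.exp (t * (∫ ω : Fin n → Z, g (v + ∑ i, d (ω i)) ∂(Measure.pi fun _ : Fin n => μ))
          + n * (B ^ 2 * t ^ 2 / 2)) := by
  induction n with
  | zero => intro v; simp
  | succ n ih =>
    intro v
    have hE := exp_lip hg t 0
    simp only [add_zero] at hE
    rw [integral_succ hE.1 hE.2 μ hd hB v n,
      integral_succ (lip_cont hg) (lip_locBdd hg) μ hd hB v n]
    set G : H → ℝ := fun w =>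
      ∫ ω : Fin n → Z, g (w + ∑ i, d (ω i)) ∂(Measure.pi fun _ : Fin n => μ) with hG
    have hGl : ∀ a b, |G a - G b| ≤ ‖a - b‖ := mean_lip hg μ hd hB n
    have hE' := exp_lip hGl t (n * (B ^ 2 * t ^ 2 / 2))
    have hint : Integrable (fun z => Real.exp (t * G (v + d z) + n * (B ^ 2 * t ^ 2 / 2))) μ :=
      integrable_comp_of_locBdd (d := fun z => v + d z) hE'.1 hE'.2 μ
        (aestronglyMeasurable_const.add hd)
        (fun z => (norm_add_le _ _).trans (add_le_add le_rfl (hB z)))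
    have h1 := integral_mono_of_nonneg
      (f := fun z => ∫ ω : Fin n → Z, Real.exp (t * g ((v + d z) + ∑ i, d (ω i)))
        ∂(Measure.pi fun _ : Fin n => μ))
      (Filter.Eventually.of_forall fun z => integral_nonneg fun ω => (Real.exp_pos _).le)
      hint (Filter.Eventually.of_forall fun z => ih (v + d z))
    refine h1.trans ?_
    simp_rw [Real.exp_add]
    rw [integral_mul_const]
    have h2 := hoeffding_step hGl μ hd hB0 hB v t
    refine (mul_le_mul_of_nonneg_right h2 (Real.exp_pos _).le).trans ?_
    rw [← Real.exp_add, ← Real.exp_add]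
    refine Real.exp_le_exp.2 (le_of_eq ?_)
    push_cast
    ring

lemma sq_norm_locBdd : LocBdd (fun w : H => ‖w‖ ^ 2) := fun R => ⟨R ^ 2, fun w hw => by
  rw [abs_of_nonneg (by positivity)]
  exact pow_le_pow_left₀ (norm_nonneg _) hw 2⟩

lemma second_moment [CompleteSpace H]
    (μ : Measure Z) [IsProbabilityMeasure μ] {d : Z → H}
    (hd : AEStronglyMeasurable d μ) {B : ℝ} (hB : ∀ z, ‖d z‖ ≤ B)
    (h0 : ∫ z, d z ∂μ = 0) (n : ℕ) :
    ∀ v : H, ∫ ω : Fin n → Z, ‖v + ∑ i, d (ω i)‖ ^ 2 ∂(Measure.pi fun _ : Fin n => μ)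
      ≤ ‖v‖ ^ 2 + n * B ^ 2 := by
  induction n with
  | zero => intro v; simp
  | succ n ih =>
    intro v
    have hdi : Integrable d μ := Integrable.of_bound hd B (Filter.Eventually.of_forall hB)
    have hc : Continuous (fun w : H => ‖w‖ ^ 2) := by fun_prop
    rw [integral_succ hc sq_norm_locBdd μ hd hB v n]
    have hi1 : Integrable (fun z => 2 * inner ℝ v (d z)) μ :=
      (hdi.const_inner v).const_mul 2
    have hint : Integrable (fun z => (‖v‖ ^ 2 + (n + 1) * B ^ 2) + 2 * inner ℝ v (d z)) μ :=
      (integrable_const _).add hi1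
    refine (integral_mono_of_nonneg
      (Filter.Eventually.of_forall fun z => integral_nonneg fun ω => by positivity)
      hint (Filter.Eventually.of_forall fun z => ?_)).trans ?_
    · refine (ih (v + d z)).trans ?_
      have h1 := norm_add_sq_real v (d z)
      have h2 := pow_le_pow_left₀ (norm_nonneg _) (hB z) 2
      simp only
      linarith
    · rw [integral_add (integrable_const _) hi1, integral_const_mul, integral_inner hdi, h0]
      simp

lemma tail_bound [CompleteSpace H]
    (μ : Measure Z) [IsProbabilityMeasure μ] {d : Z → H}
    (hd : AEStronglyMeasurable d μ) {K : ℝ} (hK : 0 < K) (hB : ∀ z, ‖d z‖ ≤ Real.sqrt (2 * K))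
    (h0 : ∫ z, d z ∂μ = 0) (m : ℕ) (hm : 1 ≤ m) (ε : ℝ) (hε : 0 < ε) :
    (Measure.pi fun _ : Fin m => μ)
      {ω | m * (Real.sqrt (2 * K / m) + ε) ≤ ‖∑ i, d (ω i)‖}
      ≤ ENNReal.ofReal (Real.exp (-(ε ^ 2) * (m : ℝ) / (4 * K))) := by
  have hm0 : (0 : ℝ) < m := by exact_mod_cast hm
  set P := (Measure.pi fun _ : Fin m => μ) with hP
  have hg : ∀ a b : H, |‖a‖ - ‖b‖| ≤ ‖a - b‖ := abs_norm_sub_norm_le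
  have hB2 : Real.sqrt (2 * K) ^ 2 = 2 * K := Real.sq_sqrt (by positivity)
  -- bias
  have hmean : ∫ ω, ‖∑ i, d (ω i)‖ ∂P ≤ m * Real.sqrt (2 * K / m) := by
    have hs := second_moment μ hd hB h0 m 0
    simp only [zero_add, norm_zero, hB2] at hs
    have hmeas := aesm_sum μ hd 0 m
    simp only [zero_add] at hmeas
    have hc : Continuous (fun w : H => ‖w‖ ^ 2) := by fun_prop
    have hi2 := integrable_sum hc sq_norm_locBdd μ hd hB 0 m
    have hi1 := integrable_sum (lip_cont hg) (lip_locBdd hg) μ hd hB 0 m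
    simp only [zero_add] at hi1 hi2
    set E := ∫ ω, ‖∑ i, d (ω i)‖ ∂P with hE
    have hv : 0 ≤ ∫ ω, (‖∑ i, d (ω i)‖ - E) ^ 2 ∂P := integral_nonneg fun ω => sq_nonneg _
    have hx : ∫ ω, (‖∑ i, d (ω i)‖ - E) ^ 2 ∂P
        = (∫ ω, ‖∑ i, d (ω i)‖ ^ 2 ∂P) - E ^ 2 := by
      have : ∀ ω : Fin m → Z, (‖∑ i, d (ω i)‖ - E) ^ 2
          = (‖∑ i, d (ω i)‖ ^ 2 - (2 * E) * ‖∑ i, d (ω i)‖) + E ^ 2 := fun ω => by ring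
      simp_rw [this]
      have hi3 : Integrable (fun ω : Fin m → Z => (2 * E) * ‖∑ i, d (ω i)‖) P :=
        hi1.const_mul _
      have hi4 : Integrable (fun ω : Fin m → Z =>
          ‖∑ i, d (ω i)‖ ^ 2 - (2 * E) * ‖∑ i, d (ω i)‖) P := hi2.sub hi3
      rw [integral_add hi4 (integrable_const _), integral_sub hi2 hi3, integral_const_mul, ← hE]
      simp
      ring
    have hsq : E ^ 2 ≤ (m * Real.sqrt (2 * K / m)) ^ 2 := by
      rw [mul_pow, Real.sq_sqrt (by positivity)]
      have : (m : ℝ) ^ 2 * (2 * K / m) = m * (2 * K) := by field_simp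
      rw [this]
      simp only [ne_eq, OfNat.ofNat_ne_zero, not_false_eq_true, zero_pow, zero_add] at hs
      linarith
    exact le_of_sq_le_sq hsq (by positivity)
  set t := ε / (2 * K) with ht
  have ht0 : 0 ≤ t := by positivity
  have hE := exp_lip hg t 0
  simp only [add_zero] at hE
  have hint := integrable_sum hE.1 hE.2 μ hd hB 0 m
  have hmgf := mgf_sum hg μ hd (Real.sqrt_nonneg _) hB t m 0
  simp only [zero_add] at hint hmgf
  have hch := ProbabilityTheory.measure_ge_le_exp_mul_mgf (μ := P)
    (X := fun ω => ‖∑ i, d (ω i)‖) (m * (Real.sqrt (2 * K / m) + ε)) ht0 hint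
  rw [← ENNReal.ofReal_toReal (measure_ne_top P _)]
  refine ENNReal.ofReal_le_ofReal (hch.trans ?_)
  refine (mul_le_mul_of_nonneg_left hmgf (Real.exp_pos _).le).trans ?_
  rw [← Real.exp_add]
  refine Real.exp_le_exp.2 ?_
  rw [hB2]
  have h1 := mul_le_mul_of_nonneg_left hmean ht0
  have h2 : -t * (m * ε) + m * (2 * K * t ^ 2 / 2) = -(ε ^ 2) * (m : ℝ) / (4 * K) := by
    rw [ht]; field_simp; ring
  rw [← h2]
  linarith

end MMDHelpers

/-- Under the null (`p = q`, `m = n`), the biased MMD satisfies the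
McDiarmid tail bound `Pr{MMD_b > √(2K/m) + ε} ≤ exp(-ε²m/(4K))`, and the threshold
`√(2K/m)(1 + √(2 log(1/α)))` gives a level-`α` test. -/
theorem mmd_biased_level_alpha_test
    {X : Type*} [MeasurableSpace X] {H : Type*} [NormedAddCommGroup H]
    [InnerProductSpace ℝ H] [CompleteSpace H]
    (φ : X → H) (K : ℝ)
    (hk0 : ∀ x y : X, 0 ≤ ⟪φ x, φ y⟫) (hkK : ∀ x y : X, ⟪φ x, φ y⟫ ≤ K)
    (hK : 0 < K)
    (p : Measure X) [IsProbabilityMeasure p] (hp : Integrable φ p)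
    (m : ℕ) (hm : 1 ≤ m)
    (M : (Fin m → X) → (Fin m → X) → ℝ)
    (hM : ∀ Xs Xs', M Xs Xs' =
      sSup {r : ℝ | ∃ f : H, ‖f‖ ≤ 1 ∧
        r = (1 / (m : ℝ)) * ∑ i : Fin m, ⟪f, φ (Xs i)⟫
              - (1 / (m : ℝ)) * ∑ i : Fin m, ⟪f, φ (Xs' i)⟫})
    (α : ℝ) (hα0 : 0 < α) (hα1 : α < 1) :
    (∀ ε : ℝ, 0 < ε →
      ((Measure.pi fun _ : Fin m => p).prod (Measure.pi fun _ : Fin m => p))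
          {ω | Real.sqrt (2 * K / m) + ε < M ω.1 ω.2}
        ≤ ENNReal.ofReal (Real.exp (-(ε ^ 2) * (m : ℝ) / (4 * K))))
    ∧ ((Measure.pi fun _ : Fin m => p).prod (Measure.pi fun _ : Fin m => p))
          {ω | Real.sqrt (2 * K / m) * (1 + Real.sqrt (2 * Real.log α⁻¹)) < M ω.1 ω.2}
        ≤ ENNReal.ofReal α := by
  have hm0 : (0 : ℝ) < m := by exact_mod_cast hm
  have main : ∀ ε : ℝ, 0 < ε →
      ((Measure.pi fun _ : Fin m => p).prod (Measure.pi fun _ : Fin m => p))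
          {ω | Real.sqrt (2 * K / m) + ε < M ω.1 ω.2}
        ≤ ENNReal.ofReal (Real.exp (-(ε ^ 2) * (m : ℝ) / (4 * K))) := by
    intro ε hε
    have hMle : ∀ Xs Xs', M Xs Xs' ≤ (1 / (m : ℝ)) * ‖∑ i, (φ (Xs i) - φ (Xs' i))‖ := by
      intro Xs Xs'
      rw [hM]
      refine csSup_le ⟨_, 0, by simp, rfl⟩ ?_
      rintro r ⟨f, hf, rfl⟩
      rw [← mul_sub, ← Finset.sum_sub_distrib]
      simp_rw [← inner_sub_right]
      rw [← inner_sum]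
      refine mul_le_mul_of_nonneg_left ?_ (by positivity)
      refine (real_inner_le_norm _ _).trans ?_
      exact mul_le_of_le_one_left (norm_nonneg _) hf
    set d : X × X → H := fun z => φ z.1 - φ z.2 with hd
    have hB : ∀ z, ‖d z‖ ≤ Real.sqrt (2 * K) := by
      intro z
      refine Real.le_sqrt_of_sq_le ?_
      rw [hd]
      simp only
      rw [norm_sub_sq_real, ← real_inner_self_eq_norm_sq, ← real_inner_self_eq_norm_sq]
      linarith [hkK z.1 z.1, hkK z.2 z.2, hk0 z.1 z.2]
    have hi1 : Integrable (fun z : X × X => φ z.1) (p.prod p) := hp.comp_fst p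
    have hi2 : Integrable (fun z : X × X => φ z.2) (p.prod p) := hp.comp_snd p
    have h0 : ∫ z, d z ∂(p.prod p) = 0 := by
      rw [hd, integral_sub hi1 hi2, integral_fun_fst, integral_fun_snd, sub_self]
    have ht := tail_bound (p.prod p) (hi1.sub hi2).1 hK hB h0 m hm ε hε
    have hmp := measurePreserving_arrowProdEquivProdArrow X X (Fin m) (fun _ => p) (fun _ => p)
    rw [← hmp.measure_preimage_equiv]
    refine (measure_mono ?_).trans ht
    intro ω hω
    have h1 := (Set.mem_ofPred_eq ▸ hω : _ < _).le.trans (hMle _ _)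
    rw [one_div, ← div_eq_inv_mul, le_div_iff₀ hm0, mul_comm] at h1
    exact h1
  refine ⟨main, ?_⟩
  have hlog : 0 < Real.log α⁻¹ := Real.log_pos ((one_lt_inv₀ hα0).2 hα1)
  have h := main (Real.sqrt (2 * K / m) * Real.sqrt (2 * Real.log α⁻¹)) (by positivity)
  rw [mul_pow, Real.sq_sqrt (by positivity), Real.sq_sqrt (by positivity)] at h
  have h2 : -(2 * K / m * (2 * Real.log α⁻¹)) * (m : ℝ) / (4 * K) = Real.log α := by
    rw [Real.log_inv]; field_simp; ring
  rw [h2, Real.exp_log hα0] at h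
  rw [mul_add, mul_one]
  exact h
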